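/- Let ε ∈ (0,1), β ∈ (0,1), and n > 0. Set ℓ = −ln ε / (1−ε) (note ℓ > 1, so β/ℓ ∈ (0,1)). If m > 0 is a real number satisfying m(1 − ε^{n/m}) = β·n(1−ε), then (n(1−ε)ℓ / (2(1 − β/ℓ))) · (β/ℓ)² ≤ m ≤ n(1−ε)ℓ / (2(1 − β/ℓ)). -/

import Mathlib

theorem exp_neg_le_one_sub_add_sq_div_two {x : ℝ} (hx : 0 ≤ x) :
    Real.exp (-x) ≤ 1 - x + x ^ 2 / 2 := by
  have h := Real.quadratic_le_exp_of_nonneg hx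
  rw [Real.exp_neg, inv_le_iff_one_le_mul₀ (Real.exp_pos x)]
  nlinarith [mul_le_mul_of_nonneg_left h
    (show 0 ≤ 1 - x + x ^ 2 / 2 by nlinarith [sq_nonneg (x - 1)]), sq_nonneg (x ^ 2)]

theorem one_sub_exp_neg_sq_le {x : ℝ} (hx : 0 ≤ x) :
    (1 - Real.exp (-x)) ^ 2 ≤ 2 * (x - (1 - Real.exp (-x))) := by
  have hderiv (y : ℝ) : HasDerivAt
      (fun y ↦ 2 * (y - (1 - Real.exp (-y))) - (1 - Real.exp (-y)) ^ 2)
      (2 * (1 - Real.exp (-y)) ^ 2) y := by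
    have hexp : HasDerivAt (fun y ↦ 1 - Real.exp (-y)) (Real.exp (-y)) y := by
      simpa using (hasDerivAt_neg y).exp.const_sub 1
    refine ((((hasDerivAt_id y).sub hexp).const_mul 2).sub (hexp.pow 2)).congr_deriv ?_
    push_cast
    ring
  have hmono := monotone_of_hasDerivAt_nonneg hderiv fun y ↦ by positivity
  have h := hmono hx
  norm_num at h
  linarith

/-- Maximum repetition length for the BEC: if `m > 0` satisfies
`m(1 − ε^{n/m}) = β·n(1−ε)` with `ℓ = −ln ε/(1−ε)`, then
`(n(1−ε)ℓ/(2(1−β/ℓ)))·(β/ℓ)² ≤ m ≤ n(1−ε)ℓ/(2(1−β/ℓ))`. -/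
theorem bec_max_repetition_length (ε β n : ℝ) (hε0 : 0 < ε) (hε1 : ε < 1)
    (hβ0 : 0 < β) (hβ1 : β < 1) (hn : 0 < n) (ℓ : ℝ) (hℓ : ℓ = -Real.log ε / (1 - ε))
    (m : ℝ) (hm : 0 < m) (heq : m * (1 - ε ^ (n / m)) = β * n * (1 - ε)) :
    n * (1 - ε) * ℓ / (2 * (1 - β / ℓ)) * (β / ℓ) ^ 2 ≤ m ∧
      m ≤ n * (1 - ε) * ℓ / (2 * (1 - β / ℓ)) := by
  have hε : 0 < 1 - ε := sub_pos.2 hε1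
  have hlog : 0 < -Real.log ε := neg_pos.2 (Real.log_neg hε0 hε1)
  have hℓ0 : 0 < ℓ := hℓ ▸ div_pos hlog hε
  have hL : -Real.log ε = (1 - ε) * ℓ := by rw [hℓ]; field_simp
  obtain ⟨x, hx⟩ : ∃ x, x = n * (1 - ε) * ℓ / m := ⟨_, rfl⟩
  have hx0 : 0 < x := hx ▸ by positivity
  have hmx : n * (1 - ε) * ℓ = m * x := by rw [hx]; field_simp
  have hpow : ε ^ (n / m) = Real.exp (-x) := by
    rw [Real.rpow_def_of_pos hε0, hx, ← neg_neg (Real.log ε), hL]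
    congr 1
    ring
  rw [hpow] at heq
  obtain ⟨c, hc⟩ : ∃ c, c = β / ℓ := ⟨_, rfl⟩
  have hβ : β = c * ℓ := by rw [hc]; field_simp
  have hcx : 1 - Real.exp (-x) = c * x := by
    apply mul_left_cancel₀ hm.ne'
    rw [heq, hβ]
    linear_combination c * hmx
  have hc1 : 0 < 1 - c := by
    have h := Real.add_one_lt_exp (neg_ne_zero.2 hx0.ne')
    by_contra! hle
    nlinarith
  have hupper := exp_neg_le_one_sub_add_sq_div_two hx0.le
  have hlower := one_sub_exp_neg_sq_le hx0.le
  rw [hcx] at hlower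
  rw [← hc, hmx]
  constructor
  · rw [div_mul_eq_mul_div, div_le_iff₀ (by positivity), mul_assoc]
    apply mul_le_mul_of_nonneg_left _ hm.le
    apply le_of_mul_le_mul_left _ hx0
    linarith
  · rw [le_div_iff₀ (by positivity)]
    apply mul_le_mul_of_nonneg_left _ hm.le
    apply le_of_mul_le_mul_left _ hx0
    linarith
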